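/- Let p be a lattice norm on ℝ² with p((1,0)) = 1 that is strictly increasing on the vertical half-line {(1,u) : u ≥ 0}, and let Φ be an Orlicz function such that for every x ∈ L^Φ(μ) with x ≠ 0 the set K(x) is nonempty. If a(Φ) = 0, then (L^Φ(μ), ‖·‖_{Φ,p}) is strictly monotone: for all x, y ∈ L^Φ(μ) with 0 ≤ x ≤ y μ-a.e. and x not μ-a.e. equal to y, one has ‖x‖_{Φ,p} < ‖y‖_{Φ,p}. -/

import Mathlib

open MeasureTheory Filter

noncomputable section

/-- The Orlicz modular `I_Φ(x) = ∫ Φ(x t) dμ` (valued in `[0,∞]`). -/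
def Iphi {Ω : Type*} [MeasurableSpace Ω] (μ : Measure Ω) (Φ : ℝ → ℝ) (x : Ω → ℝ) : ENNReal :=
  ∫⁻ t, ENNReal.ofReal (Φ (x t)) ∂μ

/-- One term `(1/k)·p((1, I_Φ(kx)))` of the defining infimum; value `∞` if `I_Φ(kx) = ∞`. -/
def aTerm {Ω : Type*} [MeasurableSpace Ω] (μ : Measure Ω) (Φ : ℝ → ℝ) (p : ℝ × ℝ → ℝ)
    (x : Ω → ℝ) (k : ℝ) : ENNReal :=
  if Iphi μ Φ (fun t => k * x t) = ⊤ then ⊤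
  else ENNReal.ofReal ((1 / k) * p (1, (Iphi μ Φ (fun t => k * x t)).toReal))

/-- The norm `‖x‖_{Φ,p} = inf_{k>0} (1/k)·p((1, I_Φ(kx)))`. -/
def aNorm {Ω : Type*} [MeasurableSpace Ω] (μ : Measure Ω) (Φ : ℝ → ℝ) (p : ℝ × ℝ → ℝ)
    (x : Ω → ℝ) : ENNReal :=
  ⨅ (k : ℝ) (_ : 0 < k), aTerm μ Φ p x k

/-- `Φ` is an Orlicz function: convex, even, vanishing at `0`, nonnegative, not identically `0`. -/
def IsOrlicz (Φ : ℝ → ℝ) : Prop :=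
  ConvexOn ℝ Set.univ Φ ∧ (∀ u, Φ (-u) = Φ u) ∧ Φ 0 = 0 ∧ (∀ u, 0 ≤ Φ u) ∧ ∃ u, Φ u ≠ 0

/-- `p` is a lattice norm on `ℝ²`: a norm which is monotone with respect to the
coordinatewise order on absolute values. -/
def IsLatticeNorm (p : ℝ × ℝ → ℝ) : Prop :=
  (∀ a b : ℝ × ℝ, p (a + b) ≤ p a + p b) ∧ (∀ (c : ℝ) (a : ℝ × ℝ), p (c • a) = |c| * p a) ∧
  (∀ a : ℝ × ℝ, p a = 0 → a = 0) ∧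
  (∀ a b : ℝ × ℝ, |a.1| ≤ |b.1| → |a.2| ≤ |b.2| → p a ≤ p b)

/-- `p` is strictly monotone: `0 ≤ a ≤ b` coordinatewise and `a ≠ b` imply `p a < p b`. -/
def StrictMonoNorm (p : ℝ × ℝ → ℝ) : Prop :=
  ∀ a b : ℝ × ℝ, 0 ≤ a.1 → 0 ≤ a.2 → a.1 ≤ b.1 → a.2 ≤ b.2 → a ≠ b → p a < p b

/-- Membership in the Orlicz space `L^Φ(μ)`. -/
def MemLphi {Ω : Type*} [MeasurableSpace Ω] (μ : Measure Ω) (Φ : ℝ → ℝ) (x : Ω → ℝ) : Prop :=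
  Measurable x ∧ ∃ l : ℝ, 0 < l ∧ Iphi μ Φ (fun t => l * x t) ≠ ⊤

/-- Membership in the space `E^Φ(μ)` of order continuous elements. -/
def MemEphi {Ω : Type*} [MeasurableSpace Ω] (μ : Measure Ω) (Φ : ℝ → ℝ) (x : Ω → ℝ) : Prop :=
  Measurable x ∧ ∀ l : ℝ, 0 < l → Iphi μ Φ (fun t => l * x t) ≠ ⊤

/-- `a(Φ) = sup{u ≥ 0 : Φ(u) = 0}`. -/
def aPhi (Φ : ℝ → ℝ) : ℝ := sSup {u : ℝ | 0 ≤ u ∧ Φ u = 0}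

/-- `K(x) = {k > 0 : ‖x‖_{Φ,p} = (1/k)·p((1, I_Φ(kx)))}`. -/
def Kset {Ω : Type*} [MeasurableSpace Ω] (μ : Measure Ω) (Φ : ℝ → ℝ) (p : ℝ × ℝ → ℝ)
    (x : Ω → ℝ) : Set ℝ :=
  {k : ℝ | 0 < k ∧ aNorm μ Φ p x = aTerm μ Φ p x k}

/-- Condition `Δ₂(ℝ₊)`: `Φ(2u) ≤ K·Φ(u)` for all `u ≥ 0`. -/
def Delta2 (Φ : ℝ → ℝ) : Prop := ∃ K : ℝ, 0 < K ∧ ∀ u : ℝ, 0 ≤ u → Φ (2 * u) ≤ K * Φ u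

/-- A non-atomic measure: every set of positive measure has a measurable subset of
strictly smaller positive measure. -/
def NonAtomic {Ω : Type*} [MeasurableSpace Ω] (μ : Measure Ω) : Prop :=
  ∀ A : Set Ω, MeasurableSet A → 0 < μ A →
    ∃ B ⊆ A, MeasurableSet B ∧ 0 < μ B ∧ μ B < μ A

/-- The modulus of monotonicity of `(ℝ², p)`:
`δ_{m,p}(ε) = inf{1 − p(b − a) : 0 ≤ a ≤ b coordinatewise, p a ≥ ε, p b = 1}`. -/
def deltaM (p : ℝ × ℝ → ℝ) (ε : ℝ) : ℝ :=
  sInf {d : ℝ | ∃ a b : ℝ × ℝ, 0 ≤ a.1 ∧ 0 ≤ a.2 ∧ a.1 ≤ b.1 ∧ a.2 ≤ b.2 ∧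
    ε ≤ p a ∧ p b = 1 ∧ d = 1 - p (b - a)}

lemma IsOrlicz.measurable {Φ : ℝ → ℝ} (hΦ : IsOrlicz Φ) : Measurable Φ :=
  (continuousOn_univ.1 (hΦ.1.continuousOn isOpen_univ)).measurable

lemma IsOrlicz.le_div_mul {Φ : ℝ → ℝ} (hΦ : IsOrlicz Φ) {u v : ℝ} (hu : 0 ≤ u) (hv : 0 < v)
    (huv : u ≤ v) : Φ u ≤ u / v * Φ v := by
  have h := hΦ.1.2 (Set.mem_univ 0) (Set.mem_univ v)
    (sub_nonneg.2 ((div_le_one hv).2 huv)) (by positivity : 0 ≤ u / v) (by ring)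
  simpa [hΦ.2.2.1, div_mul_cancel₀ u hv.ne'] using h

lemma IsOrlicz.pos_of_aPhi_eq_zero {Φ : ℝ → ℝ} (hΦ : IsOrlicz Φ) (ha : aPhi Φ = 0) {u : ℝ}
    (hu : 0 < u) : 0 < Φ u := by
  refine (hΦ.2.2.2.1 u).lt_of_ne' fun h0 => ?_
  obtain ⟨w, hw⟩ := hΦ.2.2.2.2
  have habs : Φ |w| ≠ 0 := by
    rcases abs_choice w with h | h <;> simpa [h, hΦ.2.1] using hw
  have hbdd : BddAbove {u : ℝ | 0 ≤ u ∧ Φ u = 0} := by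
    refine ⟨|w|, fun v hv => le_of_not_gt fun hlt => habs ?_⟩
    have h := hΦ.le_div_mul (abs_nonneg w) ((abs_nonneg w).trans_lt hlt) hlt.le
    rw [hv.2, mul_zero] at h
    exact le_antisymm h (hΦ.2.2.2.1 _)
  have h : u ≤ aPhi Φ := le_csSup hbdd ⟨hu.le, h0⟩
  linarith

lemma IsOrlicz.strictMonoOn {Φ : ℝ → ℝ} (hΦ : IsOrlicz Φ) (ha : aPhi Φ = 0) :
    StrictMonoOn Φ (Set.Ici 0) := by
  intro u hu v _ huv
  have hv : 0 < v := lt_of_le_of_lt hu huv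
  calc Φ u ≤ u / v * Φ v := hΦ.le_div_mul hu hv huv.le
    _ < 1 * Φ v :=
      mul_lt_mul_of_pos_right ((div_lt_one hv).2 huv) (hΦ.pos_of_aPhi_eq_zero ha hv)
    _ = Φ v := one_mul _

lemma Iphi_lt_Iphi {Ω : Type*} [MeasurableSpace Ω] {μ : Measure Ω} {Φ : ℝ → ℝ}
    (hΦ : IsOrlicz Φ) (ha : aPhi Φ = 0) {x y : Ω → ℝ} (hy : Measurable y)
    (hle : ∀ᵐ t ∂μ, 0 ≤ x t ∧ x t ≤ y t) (hne : ¬ x =ᵐ[μ] y) (hfin : Iphi μ Φ y ≠ ⊤) :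
    Iphi μ Φ x < Iphi μ Φ y := by
  have hmono := hΦ.strictMonoOn ha
  have hae : (fun t => ENNReal.ofReal (Φ (x t))) ≤ᵐ[μ] fun t => ENNReal.ofReal (Φ (y t)) := by
    filter_upwards [hle] with t ht
    exact ENNReal.ofReal_le_ofReal (hmono.monotoneOn ht.1 (ht.1.trans ht.2) ht.2)
  have hIle : Iphi μ Φ x ≤ Iphi μ Φ y := lintegral_mono_ae hae
  refine lt_of_not_ge fun hge => hne ?_
  have heq := ae_eq_of_ae_le_of_lintegral_le hae (ne_top_of_le_ne_top hfin hIle)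
    (hΦ.measurable.comp hy).ennreal_ofReal.aemeasurable hge
  filter_upwards [hle, heq] with t ht hteq
  exact hmono.injOn ht.1 (ht.1.trans ht.2)
    ((ENNReal.ofReal_eq_ofReal_iff (hΦ.2.2.2.1 _) (hΦ.2.2.2.1 _)).1 hteq)

/-- If `p` is a lattice norm on `ℝ²` with `p (1,0) = 1` strictly increasing on the vertical
half-line `{(1,u) : u ≥ 0}`, `Φ` is an Orlicz function such that `K(x) ≠ ∅` for every nonzero
`x ∈ L^Φ(μ)`, and `a(Φ) = 0`, then `(L^Φ(μ), ‖·‖_{Φ,p})` is strictly monotone. -/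
theorem stmt8 {Ω : Type*} [MeasurableSpace Ω] (μ : Measure Ω) [SigmaFinite μ]
    (Φ : ℝ → ℝ) (hΦ : IsOrlicz Φ)
    (p : ℝ × ℝ → ℝ) (hp : IsLatticeNorm p) (h10 : p (1, 0) = 1)
    (hpinc : ∀ u v : ℝ, 0 ≤ u → u < v → p (1, u) < p (1, v))
    (hK : ∀ x : Ω → ℝ, MemLphi μ Φ x → ¬ x =ᵐ[μ] 0 → (Kset μ Φ p x).Nonempty)
    (ha : aPhi Φ = 0)
    (x y : Ω → ℝ) (hx : MemLphi μ Φ x) (hy : MemLphi μ Φ y)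
    (hle : ∀ᵐ t ∂μ, 0 ≤ x t ∧ x t ≤ y t) (hne : ¬ x =ᵐ[μ] y) :
    aNorm μ Φ p x < aNorm μ Φ p y := by
  have hy0 : ¬ y =ᵐ[μ] 0 := by
    intro h
    refine hne ?_
    filter_upwards [hle, h] with t ht h0
    rw [Pi.zero_apply] at h0
    linarith
  obtain ⟨k, hk, hky⟩ := hK y hy hy0
  have hytop : aNorm μ Φ p y ≠ ⊤ := by
    obtain ⟨l, hl, hfin⟩ := hy.2
    refine ne_top_of_le_ne_top ?_ (iInf₂_le l hl)
    simp [aTerm, hfin]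
  have hIy : Iphi μ Φ (fun t => k * y t) ≠ ⊤ := by
    intro h
    exact hytop (by rw [hky, aTerm, if_pos h])
  have hlt : Iphi μ Φ (fun t => k * x t) < Iphi μ Φ (fun t => k * y t) := by
    refine Iphi_lt_Iphi hΦ ha (hy.1.const_mul k) ?_ (fun h => hne ?_) hIy
    · filter_upwards [hle] with t ht
      exact ⟨mul_nonneg hk.le ht.1, mul_le_mul_of_nonneg_left ht.2 hk.le⟩
    · filter_upwards [h] with t ht
      exact mul_left_cancel₀ hk.ne' ht
  have hp_lt := hpinc _ _ ENNReal.toReal_nonneg ((ENNReal.toReal_lt_toReal hlt.ne_top hIy).2 hlt)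
  have hp_pos : 1 ≤ p (1, (Iphi μ Φ (fun t => k * x t)).toReal) :=
    h10.ge.trans (hp.2.2.2 _ _ le_rfl (by simp))
  calc aNorm μ Φ p x ≤ aTerm μ Φ p x k := iInf₂_le k hk
    _ < aTerm μ Φ p y k := by
      rw [aTerm, aTerm, if_neg hlt.ne_top, if_neg hIy]
      have hk' : 0 < 1 / k := one_div_pos.2 hk
      exact (ENNReal.ofReal_lt_ofReal_iff (mul_pos hk' (by linarith))).2
        (mul_lt_mul_of_pos_left hp_lt hk')
    _ = aNorm μ Φ p y := hky.symm
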